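/- For every real κ with 0 < κ ≤ 1/10 and every real t with 0 < t < exp(−κ^{−2}), one has t^{2−κ} ≥ 2t² + (2t²)^{1/(1+κ/4)}. -/

import Mathlib

/-- For `t < exp(−κ⁻²)` with `κ ≤ 1/10`, the factor `t^{κ/2}` is at most `e⁻⁵ ≤ 1/4`. -/
theorem rpow_half_le_quarter {κ t : ℝ} (hκ : 0 < κ) (hκ' : κ ≤ 1 / 10)
    (ht : 0 < t) (ht' : t < Real.exp (-(1 / κ ^ 2))) : t ^ (κ / 2) ≤ 1 / 4 := by
  have hinv : 5 ≤ 1 / κ ^ 2 * (κ / 2) := by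
    have h : 1 / κ ^ 2 * (κ / 2) = 1 / (2 * κ) := by field_simp
    rw [h, le_div_iff₀ (by positivity)]
    linarith
  calc t ^ (κ / 2) ≤ Real.exp (-(1 / κ ^ 2)) ^ (κ / 2) := by gcongr
    _ = Real.exp (-(1 / κ ^ 2 * (κ / 2))) := by rw [← Real.exp_mul, neg_mul]
    _ ≤ Real.exp (-5) := by gcongr
    _ = (Real.exp 5)⁻¹ := Real.exp_neg 5
    _ ≤ 4⁻¹ := by
      gcongr
      linarith [Real.add_one_le_exp (5 : ℝ)]
    _ = 1 / 4 := by norm_num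

/-- The elementary inequality `t^{2−κ} ≥ 2t² + (2t²)^{1/(1+κ/4)}` for
`0 < κ ≤ 1/10` and `0 < t < exp(−κ⁻²)`. -/
theorem stmt11 (κ t : ℝ) (hκ : 0 < κ) (hκ' : κ ≤ 1 / 10)
    (ht : 0 < t) (ht' : t < Real.exp (-(1 / κ ^ 2))) :
    2 * t ^ 2 + (2 * t ^ 2) ^ (1 / (1 + κ / 4)) ≤ t ^ (2 - κ) := by
  have ht1 : t ≤ 1 := ht'.le.trans (Real.exp_le_one_iff.2 (by simp only [neg_nonpos]; positivity))
  set a := 1 / (1 + κ / 4) with ha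
  have ha1 : a ≤ 1 := by
    rw [ha, div_le_one (by positivity)]
    linarith
  have ha2 : 1 - κ / 4 ≤ a := by
    rw [ha, le_div_iff₀ (by positivity)]
    nlinarith
  have hsq : t ^ 2 ≤ t ^ (2 - κ / 2) := by
    rw [← Real.rpow_two]
    exact Real.rpow_le_rpow_of_exponent_ge ht ht1 (by linarith)
  have hpow : (2 * t ^ 2) ^ a ≤ 2 * t ^ (2 - κ / 2) := by
    rw [Real.mul_rpow (by norm_num) (by positivity), ← Real.rpow_two, ← Real.rpow_mul ht.le]
    gcongr ?_ * ?_
    · exact Real.rpow_le_self_of_one_le (by norm_num) ha1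
    · exact Real.rpow_le_rpow_of_exponent_ge ht ht1 (by linarith)
  have hsplit : t ^ (2 - κ / 2) = t ^ (2 - κ) * t ^ (κ / 2) := by
    rw [← Real.rpow_add ht]
    ring_nf
  have hfactor := mul_le_mul_of_nonneg_left (rpow_half_le_quarter hκ hκ' ht ht')
    (Real.rpow_nonneg ht.le (2 - κ))
  linarith
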